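/- arXiv:1006.0220 — 3 statements merged into one kernel-verified Lean document; each statement's English description precedes it below -/
import Mathlib

section
/- Let ψ be a propositional formula in disjunctive normal form over the variables x₁,…,xₙ,y₁,…,yₘ, let ψ' := ψ[¬x₁/x₁',…,¬xₙ/xₙ',¬y₁/y₁',…,¬yₘ/yₘ'] be obtained by replacing every negated variable by a corresponding fresh primed variable, and let Σ' := {Lψ'} ∪ {xᵢ ∨ Lxᵢ', Lxᵢ ∨ xᵢ' : 1 ≤ i ≤ n} ∪ {yⱼ ∨ yⱼ' : 1 ≤ j ≤ m}. Then the number of stable expansions of Σ' equals the number of truth assignments σ to x₁,…,xₙ such that every extension of σ to y₁,…,yₘ satisfies ψ (i.e., the reduction is parsimonious). -/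
/-- Autoepistemic formulas: propositional variables, Boolean connectives
`⊤, ⊥, ¬, ∧, ∨, ⊕`, and the modal operator `L` (`box`). -/
inductive AE : Type
  | var : ℕ → AE
  | top : AE
  | bot : AE
  | neg : AE → AE
  | conj : AE → AE → AE
  | disj : AE → AE → AE
  | xor : AE → AE → AE
  | box : AE → AE
  deriving DecidableEq

namespace AE

/-- Propositional evaluation of an autoepistemic formula, where `v` assigns
truth values to propositional variables and `w` assigns truth values to
`L`-prefixed formulas (which are treated as atoms). -/
def eval (v : ℕ → Bool) (w : AE → Bool) : AE → Bool
  | var n => v n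
  | top => true
  | bot => false
  | neg φ => !(eval v w φ)
  | conj φ ψ => eval v w φ && eval v w ψ
  | disj φ ψ => eval v w φ || eval v w ψ
  | xor φ ψ => (eval v w φ) != (eval v w ψ)
  | box φ => w φ

/-- Propositional consequence, treating `L`-prefixed formulas as atoms. -/
def entails (S : Set AE) (φ : AE) : Prop :=
  ∀ v w, (∀ ψ ∈ S, eval v w ψ = true) → eval v w φ = true

/-- Deductive closure. -/
def Th (S : Set AE) : Set AE := {φ | entails S φ}

/-- `Δ` is a stable expansion of `S` if `Δ = Th (S ∪ L(Δ) ∪ ¬L(Δᶜ))`. -/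
def IsStableExpansion (S Δ : Set AE) : Prop :=
  Δ = Th (S ∪ (box '' Δ) ∪ ((fun φ => neg (box φ)) '' Δᶜ))

/-- The set of subformulas of a formula (including the formula itself). -/
def subf : AE → Set AE
  | var n => {var n}
  | top => {top}
  | bot => {bot}
  | neg φ => insert (neg φ) (subf φ)
  | conj φ ψ => insert (conj φ ψ) (subf φ ∪ subf ψ)
  | disj φ ψ => insert (disj φ ψ) (subf φ ∪ subf ψ)
  | xor φ ψ => insert (xor φ ψ) (subf φ ∪ subf ψ)
  | box φ => insert (box φ) (subf φ)

/-- `SF^L(S)`: the `L`-prefixed subformulas of formulas in `S`. -/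
def SFL (S : Set AE) : Set AE := {χ | (∃ φ ∈ S, χ ∈ subf φ) ∧ ∃ ψ, χ = box ψ}

/-- `¬SF^L(S)`. -/
def negSFL (S : Set AE) : Set AE := neg '' SFL S

/-- `Λ` is an `S`-full set. -/
def IsFull (S Λ : Set AE) : Prop :=
  Λ ⊆ SFL S ∪ negSFL S ∧
  ∀ φ, box φ ∈ SFL S →
    (entails (S ∪ Λ) φ ↔ box φ ∈ Λ) ∧ (¬ entails (S ∪ Λ) φ ↔ neg (box φ) ∈ Λ)


/-- A literal over `x`-variables (`Fin n`) and `y`-variables (`Fin m`):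
a variable together with a polarity (`true` = positive). -/
abbrev Lit (n m : ℕ) := (Fin n ⊕ Fin m) × Bool

/-- A formula in disjunctive normal form: a disjunction (list) of terms,
each a conjunction (list) of literals. -/
abbrev DNF (n m : ℕ) := List (List (Lit n m))

/-- Evaluation of a literal under assignments `σ` (to the `x`s) and `τ` (to the `y`s). -/
def evalLit {n m : ℕ} (σ : Fin n → Bool) (τ : Fin m → Bool) : Lit n m → Bool
  | (Sum.inl i, b) => σ i == b
  | (Sum.inr j, b) => τ j == b

/-- Evaluation of a DNF formula. -/
def evalDNF {n m : ℕ} (σ : Fin n → Bool) (τ : Fin m → Bool) (ψ : DNF n m) : Bool :=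
  ψ.any fun tm => tm.all (evalLit σ τ)

/-- Translation of a literal into an autoepistemic formula, where a negative
literal `¬z` is replaced by the corresponding fresh primed variable `z'`:
`u` gives the names of the unprimed variables and `p` those of the primed ones. -/
def litForm {n m : ℕ} (u p : Fin n ⊕ Fin m → ℕ) : Lit n m → AE
  | (z, true) => var (u z)
  | (z, false) => var (p z)

/-- The formula `ψ'` obtained from the DNF `ψ` by replacing every negated
variable with its primed copy. -/
def dnfForm {n m : ℕ} (u p : Fin n ⊕ Fin m → ℕ) (ψ : DNF n m) : AE :=
  (ψ.map fun tm => (tm.map (litForm u p)).foldr conj top).foldr disj bot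

/-- The set `Σ' = {Lψ'} ∪ {xᵢ ∨ Lxᵢ', Lxᵢ ∨ xᵢ' : i} ∪ {yⱼ ∨ yⱼ' : j}`. -/
def sigmaDNF {n m : ℕ} (u p : Fin n ⊕ Fin m → ℕ) (ψ : DNF n m) : Set AE :=
  {box (dnfForm u p ψ)} ∪
  {φ | ∃ i : Fin n, φ = disj (var (u (Sum.inl i))) (box (var (p (Sum.inl i))))} ∪
  {φ | ∃ i : Fin n, φ = disj (box (var (u (Sum.inl i)))) (var (p (Sum.inl i)))} ∪
  {φ | ∃ j : Fin m, φ = disj (var (u (Sum.inr j))) (var (p (Sum.inr j)))}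

open Classical in
/-- The characteristic function of `Δ`, as a valuation of the `L`-prefixed formulas. -/
noncomputable def boxVal (Δ : Set AE) (φ : AE) : Bool := decide (φ ∈ Δ)

@[simp] lemma boxVal_eq_true {Δ : Set AE} {φ : AE} : boxVal Δ φ = true ↔ φ ∈ Δ := by
  simp [boxVal]

open Classical in
/-- Evaluation in the universal Kripke model whose worlds are the valuations in `M`. -/
noncomputable def kripkeEval (M : Set (ℕ → Bool)) : AE → (ℕ → Bool) → Bool
  | var n, v => v n
  | top, _ => true
  | bot, _ => false
  | neg φ, v => !(kripkeEval M φ v)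
  | conj φ ψ, v => kripkeEval M φ v && kripkeEval M ψ v
  | disj φ ψ, v => kripkeEval M φ v || kripkeEval M ψ v
  | xor φ ψ, v => (kripkeEval M φ v) != (kripkeEval M ψ v)
  | box φ, _ => decide (∀ v ∈ M, kripkeEval M φ v = true)

/-- The formulas true throughout the universal Kripke model on `M`. -/
def kripkeTheory (M : Set (ℕ → Bool)) : Set AE := {φ | ∀ v ∈ M, kripkeEval M φ v = true}

lemma eval_boxVal_kripkeTheory (M : Set (ℕ → Bool)) (φ : AE) (v : ℕ → Bool) :
    eval v (boxVal (kripkeTheory M)) φ = kripkeEval M φ v := by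
  induction φ with
  | box φ _ => exact Bool.eq_iff_iff.2 (by simp [eval, kripkeEval, kripkeTheory])
  | _ => simp_all [eval, kripkeEval]

lemma mem_kripkeTheory {M : Set (ℕ → Bool)} {φ : AE} :
    φ ∈ kripkeTheory M ↔ ∀ v ∈ M, eval v (boxVal (kripkeTheory M)) φ = true := by
  simp only [eval_boxVal_kripkeTheory]
  rfl

lemma eq_kripkeTheory_iff {M : Set (ℕ → Bool)} {Δ : Set AE} :
    Δ = kripkeTheory M ↔ ∀ φ, φ ∈ Δ ↔ ∀ v ∈ M, eval v (boxVal Δ) φ = true := by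
  constructor
  · rintro rfl φ
    exact mem_kripkeTheory
  · intro h
    have key (φ : AE) (v : ℕ → Bool) : eval v (boxVal Δ) φ = kripkeEval M φ v := by
      induction φ generalizing v with
      | box φ ih => simp [eval, kripkeEval, boxVal, h φ, ih]
      | _ => simp_all [eval, kripkeEval]
    ext φ
    simp [h φ, key, kripkeTheory]

/-- The valuations satisfying `S` when `Lφ` is read as `φ ∈ Δ`. -/
def models (S Δ : Set AE) : Set (ℕ → Bool) := {v | ∀ ψ ∈ S, eval v (boxVal Δ) ψ = true}

lemma isStableExpansion_iff {S Δ : Set AE} :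
    IsStableExpansion S Δ ↔ Δ = kripkeTheory (models S Δ) := by
  have hTh (φ : AE) : φ ∈ Th (S ∪ (box '' Δ) ∪ ((fun φ => neg (box φ)) '' Δᶜ)) ↔
      ∀ v ∈ models S Δ, eval v (boxVal Δ) φ = true := by
    constructor
    · intro h v hv
      refine h v _ ?_
      rintro ψ ((hψ | ⟨χ, hχ, rfl⟩) | ⟨χ, hχ, rfl⟩)
      · exact hv ψ hψ
      · simpa [eval] using hχ
      · simpa [eval, boxVal] using hχ
    · intro h v w hw
      have hwΔ : w = boxVal Δ := by
        funext χ
        by_cases hχ : χ ∈ Δ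
        · simpa [eval, boxVal, hχ] using hw (box χ) (.inl (.inr ⟨χ, hχ, rfl⟩))
        · simpa [eval, boxVal, hχ] using hw (neg (box χ)) (.inr ⟨χ, hχ, rfl⟩)
      subst hwΔ
      exact h v fun ψ hψ => hw ψ (.inl (.inl hψ))
  rw [eq_kripkeTheory_iff, IsStableExpansion, Set.ext_iff]
  exact forall_congr' fun φ => by rw [hTh]

section Reduction

variable {n m : ℕ} {u p : Fin n ⊕ Fin m → ℕ}

lemma eval_dnfForm (v : ℕ → Bool) (w : AE → Bool) (ψ : DNF n m) :
    eval v w (dnfForm u p ψ) = ψ.any fun tm => tm.all fun l => eval v w (litForm u p l) := by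
  have hterm (tm : List (Lit n m)) : eval v w ((tm.map (litForm u p)).foldr conj top) =
      tm.all fun l => eval v w (litForm u p l) := by
    induction tm with
    | nil => simp [eval]
    | cons l tm ih => simp [eval, ih]
  unfold dnfForm
  induction ψ with
  | nil => simp [eval]
  | cons tm ψ ih => simp only [List.map_cons, List.foldr_cons, eval, List.any_cons, ih, hterm]

/-- The valuations making `xᵢ` true for `i ∈ A`, `xᵢ'` true for `i ∈ B`, and every
`yⱼ ∨ yⱼ'` true. -/
def worlds (u p : Fin n ⊕ Fin m → ℕ) (A B : Set (Fin n)) : Set (ℕ → Bool) :=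
  {v | (∀ i ∈ A, v (u (.inl i)) = true) ∧ (∀ i ∈ B, v (p (.inl i)) = true) ∧
    ∀ j, v (u (.inr j)) = true ∨ v (p (.inr j)) = true}

/-- The worlds compatible with the assignment `σ` to the `x`-variables. -/
def assignmentWorlds (u p : Fin n ⊕ Fin m → ℕ) (σ : Fin n → Bool) : Set (ℕ → Bool) :=
  worlds u p {i | σ i = true} {i | σ i = false}

lemma models_sigmaDNF {ψ : DNF n m} {Δ : Set AE} (h : dnfForm u p ψ ∈ Δ) :
    models (sigmaDNF u p ψ) Δ =
      worlds u p {i | var (p (.inl i)) ∉ Δ} {i | var (u (.inl i)) ∉ Δ} := by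
  ext v
  constructor
  · intro hv
    refine ⟨fun i hi => ?_, fun i hi => ?_, fun j => ?_⟩
    · have := hv _ (.inl (.inl (.inr ⟨i, rfl⟩)))
      simp only [eval, Bool.or_eq_true, boxVal_eq_true] at this
      exact this.resolve_right hi
    · have := hv _ (.inl (.inr ⟨i, rfl⟩))
      simp only [eval, Bool.or_eq_true, boxVal_eq_true] at this
      exact this.resolve_left hi
    · simpa [eval] using hv _ (.inr ⟨j, rfl⟩)
  · rintro ⟨hA, hB, hy⟩ φ (((rfl | ⟨i, rfl⟩) | ⟨i, rfl⟩) | ⟨j, rfl⟩)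
    · simpa [eval] using h
    · simp only [eval, Bool.or_eq_true, boxVal_eq_true]
      exact or_iff_not_imp_right.2 (hA i)
    · simp only [eval, Bool.or_eq_true, boxVal_eq_true]
      exact or_iff_not_imp_left.2 (hB i)
    · simpa [eval] using hy j

lemma models_sigmaDNF_eq_empty {ψ : DNF n m} {Δ : Set AE} (h : dnfForm u p ψ ∉ Δ) :
    models (sigmaDNF u p ψ) Δ = ∅ := by
  ext v
  simp only [Set.mem_empty_iff_false, iff_false]
  intro hv
  exact h (by simpa [eval] using hv _ (.inl (.inl (.inl rfl))))

lemma var_u_mem_kripkeTheory_worlds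
    (hinj : Function.Injective (Sum.elim u p : (Fin n ⊕ Fin m) ⊕ (Fin n ⊕ Fin m) → ℕ))
    {A B : Set (Fin n)} {i : Fin n} :
    var (u (.inl i)) ∈ kripkeTheory (worlds u p A B) ↔ i ∈ A := by
  obtain ⟨hu, -, hup⟩ := Sum.elim_injective.1 hinj
  simp only [mem_kripkeTheory, eval]
  refine ⟨fun h => ?_, fun h v hv => hv.1 i h⟩
  by_contra hi
  have := h (fun k => decide (k ≠ u (.inl i))) ⟨fun k hk => ?_, fun k _ => ?_, fun k => ?_⟩
  · simp at this
  · simpa [hu.eq_iff] using fun hki : k = i => hi (hki ▸ hk)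
  · simpa using (hup _ _).symm
  · simp [hu.eq_iff]

lemma var_p_mem_kripkeTheory_worlds
    (hinj : Function.Injective (Sum.elim u p : (Fin n ⊕ Fin m) ⊕ (Fin n ⊕ Fin m) → ℕ))
    {A B : Set (Fin n)} {i : Fin n} :
    var (p (.inl i)) ∈ kripkeTheory (worlds u p A B) ↔ i ∈ B := by
  obtain ⟨-, hp, hup⟩ := Sum.elim_injective.1 hinj
  simp only [mem_kripkeTheory, eval]
  refine ⟨fun h => ?_, fun h v hv => hv.2.1 i h⟩
  by_contra hi
  have := h (fun k => decide (k ≠ p (.inl i))) ⟨fun k _ => ?_, fun k hk => ?_, fun k => ?_⟩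
  · simp at this
  · simpa using hup _ _
  · simpa [hp.eq_iff] using fun hki : k = i => hi (hki ▸ hk)
  · simp [hp.eq_iff]

lemma exists_mem_assignmentWorlds_eval_litForm
    (hinj : Function.Injective (Sum.elim u p : (Fin n ⊕ Fin m) ⊕ (Fin n ⊕ Fin m) → ℕ))
    (σ : Fin n → Bool) (τ : Fin m → Bool) :
    ∃ v ∈ assignmentWorlds u p σ, ∀ w l, eval v w (litForm u p l) = evalLit σ τ l := by
  let s : Fin n ⊕ Fin m → Bool := Sum.elim σ τ
  let v : ℕ → Bool := Function.extend (Sum.elim u p) (Sum.elim s fun z => !s z) fun _ => false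
  have hvu (z) : v (u z) = s z := hinj.extend_apply _ _ (.inl z)
  have hvp (z) : v (p z) = !s z := hinj.extend_apply _ _ (.inr z)
  refine ⟨v, ⟨fun i hi => ?_, fun i hi => ?_, fun j => ?_⟩, ?_⟩
  · simpa [hvu, s] using hi
  · simpa [hvp, s] using hi
  · cases h : τ j <;> simp [hvu, hvp, s, h]
  · rintro w ⟨i | j, _ | _⟩ <;> simp [litForm, eval, evalLit, hvu, hvp, s]

lemma dnfForm_mem_kripkeTheory_assignmentWorlds
    (hinj : Function.Injective (Sum.elim u p : (Fin n ⊕ Fin m) ⊕ (Fin n ⊕ Fin m) → ℕ))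
    (σ : Fin n → Bool) (ψ : DNF n m) :
    dnfForm u p ψ ∈ kripkeTheory (assignmentWorlds u p σ) ↔
      ∀ τ : Fin m → Bool, evalDNF σ τ ψ = true := by
  simp only [mem_kripkeTheory, eval_dnfForm]
  constructor
  · intro h τ
    obtain ⟨v, hv, hlit⟩ := exists_mem_assignmentWorlds_eval_litForm hinj σ τ
    simpa only [evalDNF, hlit] using h v hv
  · rintro h v ⟨hA, hB, hy⟩
    have hlit (l : Lit n m) (hl : evalLit σ (fun j => v (u (.inr j))) l = true) :
        eval v (boxVal (kripkeTheory (assignmentWorlds u p σ))) (litForm u p l) = true := by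
      rcases l with ⟨i | j, _ | _⟩ <;> simp only [evalLit, beq_iff_eq] at hl
      · exact hB i hl
      · exact hA i hl
      · exact (hy j).resolve_left (by simp [hl])
      · exact hl
    have := h fun j => v (u (.inr j))
    simp only [evalDNF, List.any_eq_true, List.all_eq_true] at this ⊢
    obtain ⟨tm, htm, hall⟩ := this
    exact ⟨tm, htm, fun l hl => hlit l (hall l hl)⟩

lemma isStableExpansion_sigmaDNF_iff
    (hinj : Function.Injective (Sum.elim u p : (Fin n ⊕ Fin m) ⊕ (Fin n ⊕ Fin m) → ℕ))
    {ψ : DNF n m} {Δ : Set AE} :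
    IsStableExpansion (sigmaDNF u p ψ) Δ ↔
      ∃ σ : Fin n → Bool, (∀ τ : Fin m → Bool, evalDNF σ τ ψ = true) ∧
        kripkeTheory (assignmentWorlds u p σ) = Δ := by
  rw [isStableExpansion_iff]
  constructor
  · intro h
    have hψ : dnfForm u p ψ ∈ Δ := by
      by_contra hψ
      rw [models_sigmaDNF_eq_empty hψ] at h
      exact hψ (h ▸ by simp [kripkeTheory])
    rw [models_sigmaDNF hψ] at h
    have hup (i : Fin n) : var (u (.inl i)) ∈ Δ ↔ var (p (.inl i)) ∉ Δ := by
      have := var_u_mem_kripkeTheory_worlds hinj (i := i)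
        (A := {i | var (p (.inl i)) ∉ Δ}) (B := {i | var (u (.inl i)) ∉ Δ})
      rwa [← h] at this
    have hσ : Δ = kripkeTheory
        (assignmentWorlds u p fun i => boxVal Δ (var (u (.inl i)))) := by
      simpa [assignmentWorlds, ← hup, ← Bool.not_eq_true] using h
    exact ⟨_, (dnfForm_mem_kripkeTheory_assignmentWorlds hinj _ ψ).1 (hσ ▸ hψ), hσ.symm⟩
  · rintro ⟨σ, hσ, rfl⟩
    rw [models_sigmaDNF ((dnfForm_mem_kripkeTheory_assignmentWorlds hinj σ ψ).2 hσ)]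
    simp [assignmentWorlds, var_u_mem_kripkeTheory_worlds hinj,
      var_p_mem_kripkeTheory_worlds hinj]

lemma injective_kripkeTheory_assignmentWorlds
    (hinj : Function.Injective (Sum.elim u p : (Fin n ⊕ Fin m) ⊕ (Fin n ⊕ Fin m) → ℕ)) :
    Function.Injective fun σ : Fin n → Bool => kripkeTheory (assignmentWorlds u p σ) := by
  intro σ σ' h
  funext i
  have := Set.ext_iff.1 h (var (u (.inl i)))
  simpa [assignmentWorlds, var_u_mem_kripkeTheory_worlds hinj, ← Bool.eq_iff_iff] using this

end Reduction

/-- The number of stable expansions of `Σ'` equals the number of assignments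
`σ` to `x₁,…,xₙ` all of whose extensions to `y₁,…,yₘ` satisfy `ψ`. -/
theorem sigmaDNF_parsimonious (n m : ℕ) (u p : Fin n ⊕ Fin m → ℕ)
    (hinj : Function.Injective (Sum.elim u p : (Fin n ⊕ Fin m) ⊕ (Fin n ⊕ Fin m) → ℕ))
    (ψ : DNF n m) :
    {Δ : Set AE | IsStableExpansion (sigmaDNF u p ψ) Δ}.ncard =
    {σ : Fin n → Bool | ∀ τ : Fin m → Bool, evalDNF σ τ ψ = true}.ncard := by
  rw [← Set.ncard_image_of_injective _ (injective_kripkeTheory_assignmentWorlds hinj)]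
  congr 1
  ext Δ
  exact isStableExpansion_sigmaDNF_iff hinj

end AE
end

section
/- Let Σ be a set of autoepistemic formulas each of which is built from propositional variables and the Boolean constants ⊤, ⊥ using only the binary connective conjunction ∧ and the modal operator L (i.e., Σ consists of autoepistemic E-formulas). Then Σ has at most one consistent stable expansion. -/
namespace AE

/-- `E`-formulas: built from variables and `⊤, ⊥` using only `∧` and `L`. -/
def IsEFormula : AE → Prop
  | var _ => True
  | top => True
  | bot => True
  | conj φ ψ => IsEFormula φ ∧ IsEFormula ψ
  | box φ => IsEFormula φ
  | _ => False

/-- On `E`-formulas, the values of the variables and those of the `L`-atoms can be taken from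
two different satisfying valuations. -/
theorem IsEFormula.eval_mix {v₁ v₂ : ℕ → Bool} {w₁ w₂ : AE → Bool} {φ : AE}
    (hφ : IsEFormula φ) (h₁ : eval v₁ w₁ φ = true) (h₂ : eval v₂ w₂ φ = true) :
    eval v₁ w₂ φ = true := by
  induction φ with
  | conj φ ψ ihφ ihψ =>
    simp only [eval, Bool.and_eq_true] at h₁ h₂ ⊢
    exact ⟨ihφ hφ.1 h₁.1 h₂.1, ihψ hφ.2 h₁.2 h₂.2⟩
  | _ => simp_all [eval, IsEFormula]

open Classical in
/-- A stable expansion `Δ` consists of the consequences of `S` when every `L`-atom is read as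
membership in `Δ`. -/
theorem IsStableExpansion.mem_iff {S Δ : Set AE} (h : IsStableExpansion S Δ) (φ : AE) :
    φ ∈ Δ ↔ ∀ v, (∀ ψ ∈ S, eval v (fun χ => decide (χ ∈ Δ)) ψ = true) →
      eval v (fun χ => decide (χ ∈ Δ)) φ = true := by
  have hmem : φ ∈ Δ ↔ entails (S ∪ (box '' Δ) ∪ ((fun φ => neg (box φ)) '' Δᶜ)) φ :=
    Set.ext_iff.mp h φ
  rw [hmem]
  constructor
  · intro hφ v hv
    refine hφ v _ ?_
    rintro ψ ((hψ | ⟨χ, hχ, rfl⟩) | ⟨χ, hχ, rfl⟩)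
    · exact hv ψ hψ
    · simpa [eval] using hχ
    · simpa [eval] using hχ
  · intro hφ v w hw
    obtain rfl : w = fun χ => decide (χ ∈ Δ) := by
      funext χ
      by_cases hχ : χ ∈ Δ
      · simpa [eval, hχ] using hw (box χ) (Or.inl (Or.inr ⟨χ, hχ, rfl⟩))
      · simpa [eval, hχ] using hw (neg (box χ)) (Or.inr ⟨χ, hχ, rfl⟩)
    exact hφ v fun ψ hψ => hw ψ (Or.inl (Or.inl hψ))

/-- A set of autoepistemic `E`-formulas has at most one consistent stable
expansion. -/
theorem E_at_most_one_consistent_expansion (S : Set AE)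
    (hS : ∀ φ ∈ S, IsEFormula φ) :
    ∀ Δ₁ Δ₂ : Set AE, IsStableExpansion S Δ₁ → IsStableExpansion S Δ₂ →
      Δ₁ ≠ Set.univ → Δ₂ ≠ Set.univ → Δ₁ = Δ₂ := by
  classical
  intro Δ₁ Δ₂ h₁ h₂ hne₁ hne₂
  obtain ⟨φ₁, hφ₁⟩ := (Set.ne_univ_iff_exists_notMem _).mp hne₁
  obtain ⟨φ₂, hφ₂⟩ := (Set.ne_univ_iff_exists_notMem _).mp hne₂
  rw [h₁.mem_iff] at hφ₁
  rw [h₂.mem_iff] at hφ₂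
  push Not at hφ₁ hφ₂
  obtain ⟨v₁, hv₁, -⟩ := hφ₁
  obtain ⟨v₂, hv₂, -⟩ := hφ₂
  have models_iff (v : ℕ → Bool) :
      (∀ ψ ∈ S, eval v (fun χ => decide (χ ∈ Δ₁)) ψ = true) ↔
        ∀ ψ ∈ S, eval v (fun χ => decide (χ ∈ Δ₂)) ψ = true :=
    ⟨fun h ψ hψ => (hS ψ hψ).eval_mix (h ψ hψ) (hv₂ ψ hψ),
      fun h ψ hψ => (hS ψ hψ).eval_mix (h ψ hψ) (hv₁ ψ hψ)⟩
  have mem_iff_of_eval_eq {φ : AE}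
      (h : ∀ v, eval v (fun χ => decide (χ ∈ Δ₁)) φ = eval v (fun χ => decide (χ ∈ Δ₂)) φ) :
      φ ∈ Δ₁ ↔ φ ∈ Δ₂ := by
    rw [h₁.mem_iff, h₂.mem_iff]
    exact forall_congr' fun v => by rw [models_iff, h]
  have eval_eq (φ : AE) (v : ℕ → Bool) :
      eval v (fun χ => decide (χ ∈ Δ₁)) φ = eval v (fun χ => decide (χ ∈ Δ₂)) φ := by
    induction φ generalizing v with
    | box φ ih => simp only [eval, mem_iff_of_eval_eq ih]
    | _ => simp_all only [eval]
  exact Set.ext fun φ => mem_iff_of_eval_eq (eval_eq φ)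

end AE
end

section
/- Let Σ be a set of autoepistemic formulas and φ an autoepistemic formula, all built using only the connectives ⊕ (exclusive or) and the constant ⊤, and let p be a propositional variable occurring neither in Σ nor in φ. Then φ is contained in every stable expansion of Σ if and only if Σ' := Σ ∪ {Lφ ⊕ p, Lp} has no consistent stable expansion. -/
namespace AE

/-- Formulas built using only the connectives `⊕` and the constant `⊤`
(besides variables and the modal operator `L`). -/
def IsXorTop : AE → Prop
  | var _ => True
  | top => True
  | xor φ ψ => IsXorTop φ ∧ IsXorTop ψ
  | box φ => IsXorTop φ
  | _ => False

/-- Satisfaction of a formula at the valuation `v`, where `L` quantifies over the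
valuations in `V`. -/
def Sat (V : Set (ℕ → Bool)) : AE → (ℕ → Bool) → Prop
  | var n, v => v n = true
  | top, _ => True
  | bot, _ => False
  | neg φ, v => ¬ Sat V φ v
  | conj φ ψ, v => Sat V φ v ∧ Sat V ψ v
  | disj φ ψ, v => Sat V φ v ∨ Sat V ψ v
  | xor φ ψ, v => ¬ (Sat V φ v ↔ Sat V ψ v)
  | box φ, _ => ∀ u ∈ V, Sat V φ u

lemma mem_subf_self (φ : AE) : φ ∈ subf φ := by
  cases φ <;> simp [subf]

lemma eval_iff_sat {V : Set (ℕ → Bool)} {w : AE → Bool} {ψ : AE}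
    (h : ∀ χ, box χ ∈ subf ψ → (∀ v, eval v w χ = true ↔ Sat V χ v) →
      (w χ = true ↔ ∀ u ∈ V, Sat V χ u)) (v : ℕ → Bool) :
    eval v w ψ = true ↔ Sat V ψ v := by
  induction ψ generalizing v with
  | var n => simp [eval, Sat]
  | top => simp [eval, Sat]
  | bot => simp [eval, Sat]
  | neg φ ih =>
    rw [Sat, ← ih (fun χ hχ => h χ (by simp [subf, hχ]))]
    simp [eval]
  | conj φ ψ ih₁ ih₂ =>
    rw [Sat, ← ih₁ (fun χ hχ => h χ (by simp [subf, hχ])),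
      ← ih₂ (fun χ hχ => h χ (by simp [subf, hχ]))]
    simp [eval]
  | disj φ ψ ih₁ ih₂ =>
    rw [Sat, ← ih₁ (fun χ hχ => h χ (by simp [subf, hχ])),
      ← ih₂ (fun χ hχ => h χ (by simp [subf, hχ]))]
    simp [eval]
  | xor φ ψ ih₁ ih₂ =>
    rw [Sat, ← ih₁ (fun χ hχ => h χ (by simp [subf, hχ])),
      ← ih₂ (fun χ hχ => h χ (by simp [subf, hχ]))]
    simp only [eval]
    cases eval v w φ <;> cases eval v w ψ <;> simp
  | box φ ih =>
    exact h φ (mem_subf_self _) (ih fun χ hχ => h χ (by simp [subf, hχ]))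

open Classical in
/-- The belief part of a stable expansion fixes the values of all `L`-atoms. -/
lemma isStableExpansion_iff_s14 (S Δ : Set AE) :
    IsStableExpansion S Δ ↔ ∀ ψ, ψ ∈ Δ ↔
      ∀ v, (∀ σ ∈ S, eval v (fun χ => decide (χ ∈ Δ)) σ = true) →
        eval v (fun χ => decide (χ ∈ Δ)) ψ = true := by
  unfold IsStableExpansion
  rw [Set.ext_iff]
  refine forall_congr' fun ψ => iff_congr Iff.rfl ?_
  constructor
  · intro h v hv
    refine h v _ ?_
    rintro χ ((hχ | ⟨χ, hχ, rfl⟩) | ⟨χ, hχ, rfl⟩)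
    · exact hv χ hχ
    · simpa [eval] using hχ
    · simpa [eval] using hχ
  · intro h v w hvw
    have hw : w = fun χ => decide (χ ∈ Δ) := by
      funext χ
      by_cases hχ : χ ∈ Δ
      · simpa [eval, hχ] using hvw (box χ) (Or.inl (Or.inr ⟨χ, hχ, rfl⟩))
      · simpa [eval, hχ] using hvw (neg (box χ)) (Or.inr ⟨χ, hχ, rfl⟩)
    subst hw
    exact h v fun σ hσ => hvw σ (Or.inl (Or.inl hσ))

/-- Stable expansions of `S` are the theories of the sets `V` of valuations that consist
exactly of the models of `S` relative to `V`. -/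
lemma isStableExpansion_iff_exists (S Δ : Set AE) :
    IsStableExpansion S Δ ↔ ∃ V : Set (ℕ → Bool),
      (∀ v, v ∈ V ↔ ∀ σ ∈ S, Sat V σ v) ∧ Δ = {ψ | ∀ v ∈ V, Sat V ψ v} := by
  classical
  rw [isStableExpansion_iff_s14]
  constructor
  · intro h
    set w : AE → Bool := fun χ => decide (χ ∈ Δ) with hw
    set V : Set (ℕ → Bool) := {v | ∀ σ ∈ S, eval v w σ = true} with hV
    have key : ∀ ψ v, eval v w ψ = true ↔ Sat V ψ v := fun ψ v =>
      eval_iff_sat (fun χ _ hχ => by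
        rw [hw, decide_eq_true_iff, h χ]
        exact forall₂_congr fun u _ => hχ u) v
    refine ⟨V, fun v => ?_, ?_⟩
    · exact forall₂_congr fun σ _ => key σ v
    · ext ψ
      rw [h ψ]
      exact forall₂_congr fun u _ => key ψ u
  · rintro ⟨V, hV, rfl⟩ ψ
    have key : ∀ ψ v, eval v (fun χ => decide (χ ∈ {ψ | ∀ v ∈ V, Sat V ψ v})) ψ = true ↔
        Sat V ψ v := fun ψ v => eval_iff_sat (fun χ _ _ => by simp) v
    simp only [key, ← hV]
    rfl

lemma sat_update_iff {p : ℕ} {ψ : AE} (hψ : var p ∉ subf ψ) (V : Set (ℕ → Bool))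
    (v : ℕ → Bool) (b : Bool) : Sat V ψ (Function.update v p b) ↔ Sat V ψ v := by
  induction ψ with
  | var n =>
    have hn : n ≠ p := by rintro rfl; exact hψ (mem_subf_self _)
    simp [Sat, Function.update_of_ne hn]
  | top => rfl
  | bot => rfl
  | neg φ ih => simp_all [subf, Sat]
  | conj φ ψ ih₁ ih₂ => simp_all [subf, Sat]
  | disj φ ψ ih₁ ih₂ => simp_all [subf, Sat]
  | xor φ ψ ih₁ ih₂ => simp_all [subf, Sat]
  | box φ ih => rfl

/-- If `V` arises from `V'` by forgetting `p`, which is true throughout `V'`, then `V` and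
`V'` satisfy the same formulas without `p`. -/
lemma sat_iff_sat_of_forget {p : ℕ} {ψ : AE} (hψ : var p ∉ subf ψ) {V V' : Set (ℕ → Bool)}
    (hp : ∀ v ∈ V', v p = true) (hV : ∀ v, v ∈ V ↔ Function.update v p true ∈ V')
    (v : ℕ → Bool) : Sat V ψ v ↔ Sat V' ψ v := by
  induction ψ generalizing v with
  | var n => rfl
  | top => rfl
  | bot => rfl
  | neg φ ih => simp_all [subf, Sat]
  | conj φ ψ ih₁ ih₂ => simp_all [subf, Sat]
  | disj φ ψ ih₁ ih₂ => simp_all [subf, Sat]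
  | xor φ ψ ih₁ ih₂ => simp_all [subf, Sat]
  | box φ ih =>
    have hφ : var p ∉ subf φ := fun h => hψ (by simp [subf, h])
    constructor
    · intro h u hu
      refine (ih hφ u).1 (h u ((hV u).2 ?_))
      rwa [← hp u hu, Function.update_eq_self]
    · intro h u hu
      exact (ih hφ u).2 ((sat_update_iff hφ V' u true).1 (h _ ((hV u).1 hu)))

/-- Cautious reasoning reduces to (non-)existence of consistent expansions for
`⊕,⊤`-formulas: `φ` is in every stable expansion of `Σ` iff
`Σ' = Σ ∪ {Lφ ⊕ p, Lp}` has no consistent stable expansion (`p` fresh). -/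
theorem cautious_reduces_to_consistent_exp (S : Set AE) (φ : AE) (p : ℕ)
    (hS : ∀ ρ ∈ S, IsXorTop ρ) (hφ : IsXorTop φ)
    (hpS : ∀ ρ ∈ S, var p ∉ subf ρ) (hpφ : var p ∉ subf φ) :
    (∀ Δ : Set AE, IsStableExpansion S Δ → φ ∈ Δ) ↔
    ¬ ∃ Δ : Set AE,
        IsStableExpansion (S ∪ {xor (box φ) (var p), box (var p)}) Δ ∧ Δ ≠ Set.univ := by
  rw [← not_iff_not, not_not]
  push Not
  constructor
  · rintro ⟨Δ, hΔ, hφΔ⟩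
    obtain ⟨V, hV, rfl⟩ := (isStableExpansion_iff_exists S Δ).1 hΔ
    have hinv : ∀ v b, Function.update v p b ∈ V ↔ v ∈ V := fun v b => by
      rw [hV, hV]
      exact forall₂_congr fun σ hσ => sat_update_iff (hpS σ hσ) V v b
    set V' : Set (ℕ → Bool) := {v | v ∈ V ∧ v p = true} with hV'
    have hsat : ∀ ψ, var p ∉ subf ψ → ∀ v, Sat V ψ v ↔ Sat V' ψ v := fun ψ hψ v =>
      sat_iff_sat_of_forget hψ (fun v hv => hv.2) (fun v => by simp [hV', hinv]) v
    have hbox : ∀ v, ¬ Sat V' (box φ) v := fun v h =>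
      hφΔ ((hsat (box φ) (by simpa [subf] using hpφ) v).2 h)
    have hboxp : ∀ v, Sat V' (box (var p)) v := fun v u hu => hu.2
    refine ⟨_, (isStableExpansion_iff_exists _ _).2 ⟨V', fun v => ?_, rfl⟩, fun h => ?_⟩
    · have hS' : v ∈ V ↔ ∀ σ ∈ S, Sat V' σ v := by
        rw [hV]
        exact forall₂_congr fun σ hσ => hsat σ (hpS σ hσ) v
      have hxor : Sat V' (xor (box φ) (var p)) v ↔ v p = true := by
        rw [Sat, iff_false_left (hbox v), not_not, Sat]
      simp only [Set.mem_union, Set.mem_insert_iff, Set.mem_singleton_iff, or_imp,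
        forall_and, forall_eq, ← hS', hxor, hboxp, and_true]
      rfl
    · have hbot : bot ∈ {ψ | ∀ v ∈ V', Sat V' ψ v} := h ▸ Set.mem_univ _
      exact hbox (fun _ => true) fun u hu => (hbot u hu).elim
  · rintro ⟨Δ, hΔ, hne⟩
    obtain ⟨V', hV', rfl⟩ := (isStableExpansion_iff_exists _ Δ).1 hΔ
    have hnon : ∃ u, u ∈ V' := by
      by_contra! hempty
      exact hne (Set.eq_univ_of_forall fun ψ v hv => (hempty v hv).elim)
    obtain ⟨u, hu⟩ := hnon
    have hp : ∀ v ∈ V', v p = true := (hV' u).1 hu (box (var p)) (by simp)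
    have hbox : ∀ v, ¬ Sat V' (box φ) v := fun v h =>
      (hV' u).1 hu (xor (box φ) (var p)) (by simp) (iff_of_true h (hp u hu))
    set V : Set (ℕ → Bool) := {v | Function.update v p true ∈ V'} with hV
    have hsat : ∀ ψ, var p ∉ subf ψ → ∀ v, Sat V ψ v ↔ Sat V' ψ v := fun ψ hψ v =>
      sat_iff_sat_of_forget hψ hp (fun _ => Iff.rfl) v
    refine ⟨_, (isStableExpansion_iff_exists _ _).2 ⟨V, fun v => ?_, rfl⟩, fun h => ?_⟩
    · have hS' : (∀ σ ∈ S, Sat V σ v) ↔ ∀ σ ∈ S, Sat V' σ (Function.update v p true) :=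
        forall₂_congr fun σ hσ =>
          (hsat σ (hpS σ hσ) v).trans (sat_update_iff (hpS σ hσ) V' v true).symm
      have hxor : Sat V' (xor (box φ) (var p)) (Function.update v p true) := by
        rw [Sat, iff_false_left (hbox _), not_not, Sat, Function.update_self]
      have hboxp : Sat V' (box (var p)) (Function.update v p true) := hp
      rw [hS', hV, Set.mem_ofPred_eq, hV']
      simp only [Set.mem_union, Set.mem_insert_iff, Set.mem_singleton_iff, or_imp,
        forall_and, forall_eq, hxor, hboxp, and_true]
    · exact hbox u ((hsat (box φ) (by simpa [subf] using hpφ) u).1 h)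

end AE
end
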